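/- arXiv:2205.03451 — 6 statements merged into one kernel-verified Lean document; each statement's English description precedes it below -/
import Mathlib

section
/- Let s ≥ 1 and let 1 ≤ j ≤ s. Let p_1 < p_2 < ⋯ < p_j be positions with 1 ≤ p_i, p_i + 1 ≤ 2s, and p_{i+1} ≥ p_i + 2 for all i. Then the number of Dyck words of semilength s that have the character '(' at position p_i and the character ')' at position p_i + 1 (1-indexed) for every i = 1, …, j equals the Catalan number C_{s−j}. -/
/-- A Dyck word, encoded as a list of booleans where `true` stands for `'('` and
`false` stands for `')'`: the total numbers of `'('` and `')'` agree, and every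
prefix contains at least as many `'('` as `')'`. -/
def IsDyckList (w : List Bool) : Prop :=
  w.count true = w.count false ∧
  ∀ n : ℕ, (w.take n).count false ≤ (w.take n).count true

/-- The bijection between Dyck steps and booleans sending the up step to `true`. -/
def dyckStepEquivBool : DyckStep ≃ Bool where
  toFun
    | .U => true
    | .D => false
  invFun
    | true => .U
    | false => .D
  left_inv x := by cases x <;> rfl
  right_inv x := by cases x <;> rfl

theorem count_map_dyckStepEquivBool (l : List DyckStep) (x : DyckStep) :
    (l.map dyckStepEquivBool).count (dyckStepEquivBool x) = l.count x :=
  List.count_map_of_injective l _ dyckStepEquivBool.injective x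

theorem count_map_dyckStepEquivBool_symm (l : List Bool) (x : Bool) :
    (l.map dyckStepEquivBool.symm).count (dyckStepEquivBool.symm x) = l.count x :=
  List.count_map_of_injective l _ dyckStepEquivBool.symm.injective x

theorem DyckWord.isDyckList_map (p : DyckWord) :
    IsDyckList (p.toList.map dyckStepEquivBool) := by
  have h := fun l => count_map_dyckStepEquivBool l .U
  have h' := fun l => count_map_dyckStepEquivBool l .D
  simp only [dyckStepEquivBool, Equiv.coe_fn_mk] at h h'
  refine ⟨?_, fun n => ?_⟩
  · exact (h _).trans (p.count_U_eq_count_D.trans (h' _).symm)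
  · rw [← List.map_take]
    exact (h' _).trans_le ((p.count_D_le_count_U n).trans_eq (h _).symm)

/-- The Dyck word given by a boolean list satisfying `IsDyckList`. -/
def IsDyckList.toDyckWord {w : List Bool} (hw : IsDyckList w) : DyckWord where
  toList := w.map dyckStepEquivBool.symm
  count_U_eq_count_D :=
    (count_map_dyckStepEquivBool_symm w true).trans
      (hw.1.trans (count_map_dyckStepEquivBool_symm w false).symm)
  count_D_le_count_U n := by
    rw [← List.map_take]
    exact (count_map_dyckStepEquivBool_symm _ false).trans_le
      ((hw.2 n).trans_eq (count_map_dyckStepEquivBool_symm _ true).symm)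

/-- Mathlib's Dyck words of semilength `s` correspond to the boolean Dyck lists of
length `2 * s`. -/
def dyckWordEquivDyckList (s : ℕ) :
    {p : DyckWord // p.semilength = s} ≃ {w : List Bool | w.length = 2 * s ∧ IsDyckList w} where
  toFun p := ⟨p.1.toList.map dyckStepEquivBool, by
    rw [List.length_map, ← p.1.two_mul_semilength_eq_length, p.2], p.1.isDyckList_map⟩
  invFun w := ⟨w.2.2.toDyckWord, by
    have h := w.2.2.toDyckWord.two_mul_semilength_eq_length
    have h' : w.2.2.toDyckWord.toList.length = 2 * s := (List.length_map _).trans w.2.1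
    omega⟩
  left_inv p := by
    ext1
    ext1
    simp [IsDyckList.toDyckWord]
  right_inv w := by
    ext1
    simp [IsDyckList.toDyckWord]

theorem ncard_isDyckList (s : ℕ) :
    Set.ncard {w : List Bool | w.length = 2 * s ∧ IsDyckList w} = catalan s := by
  rw [← DyckWord.card_dyckWord_semilength_eq_catalan, ← Nat.card_coe_set_eq,
    ← Nat.card_congr (dyckWordEquivDyckList s), Nat.card_eq_fintype_card]

theorem isDyckList_append_nesting_iff (u v : List Bool) :
    IsDyckList (u ++ true :: false :: v) ↔ IsDyckList (u ++ v) := by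
  have key : ∀ k, (u ++ true :: false :: v).take (u.length + (k + 2)) =
      u ++ true :: false :: v.take k := fun k => by
    rw [List.take_length_add_append]; rfl
  refine and_congr (by simp; omega) ⟨fun h n => ?_, fun h n => ?_⟩
  · rcases le_total n u.length with hn | hn
    · have := h n
      rwa [List.take_append_of_le_length hn] at this ⊢
    · obtain ⟨k, rfl⟩ := Nat.exists_eq_add_of_le hn
      have := h (u.length + (k + 2))
      rw [key] at this
      rw [List.take_length_add_append]
      simp at this ⊢
      omega
  · rcases le_total n u.length with hn | hn
    · have := h n
      rwa [List.take_append_of_le_length hn] at this ⊢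
    · obtain ⟨k, rfl⟩ := Nat.exists_eq_add_of_le hn
      match k with
      | 0 => simpa using h u.length
      | 1 =>
        have := h u.length
        simp only [List.take_left'] at this
        rw [List.take_length_add_append]
        simp
        omega
      | k + 2 =>
        have := h (u.length + k)
        rw [List.take_length_add_append] at this
        rw [key]
        simp at this ⊢
        omega

/-- Insert the nesting `true, false` into `w` so that it starts at index `q`. -/
def insertNesting (q : ℕ) (w : List Bool) : List Bool :=
  w.take q ++ true :: false :: w.drop q

theorem isDyckList_insertNesting_iff (q : ℕ) (w : List Bool) :
    IsDyckList (insertNesting q w) ↔ IsDyckList w := by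
  rw [insertNesting, isDyckList_append_nesting_iff, List.take_append_drop]

theorem length_insertNesting (q : ℕ) (w : List Bool) :
    (insertNesting q w).length = w.length + 2 := by
  simp [insertNesting]
  omega

theorem getElem?_insertNesting_of_lt {q k : ℕ} {w : List Bool} (hq : q ≤ w.length) (hk : k < q) :
    (insertNesting q w)[k]? = w[k]? := by
  rw [insertNesting, List.getElem?_append_left (by simp; omega), List.getElem?_take_of_lt hk]

theorem getElem?_insertNesting_self {q : ℕ} {w : List Bool} (hq : q ≤ w.length) :
    (insertNesting q w)[q]? = some true := by
  simp [insertNesting, hq]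

theorem getElem?_insertNesting_succ {q : ℕ} {w : List Bool} (hq : q ≤ w.length) :
    (insertNesting q w)[q + 1]? = some false := by
  simp [insertNesting, hq]

theorem insertNesting_injective (q : ℕ) : Function.Injective (insertNesting q) := by
  intro w w' h
  have hl := congrArg List.length h
  rw [length_insertNesting, length_insertNesting] at hl
  obtain ⟨h₁, h₂⟩ := List.append_inj h (by simp; omega)
  rw [← List.take_append_drop q w, h₁, (List.cons.inj (List.cons.inj h₂).2).2,
    List.take_append_drop]

theorem exists_insertNesting_eq {q : ℕ} {w : List Bool} (h : w[q]? = some true)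
    (h' : w[q + 1]? = some false) : ∃ v, insertNesting q v = w := by
  obtain ⟨hq, e⟩ := List.getElem?_eq_some_iff.1 h
  obtain ⟨hq', e'⟩ := List.getElem?_eq_some_iff.1 h'
  have hlen : (w.take q).length = q := by simp; omega
  refine ⟨w.take q ++ w.drop (q + 2), ?_⟩
  rw [insertNesting, List.take_left' hlen, List.drop_left' hlen, ← e, ← e',
    ← List.drop_eq_getElem_cons, ← List.drop_eq_getElem_cons, List.take_append_drop]

theorem ncard_isDyckList_with_nestings (j : ℕ) : ∀ (s : ℕ), j ≤ s → ∀ p : Fin j → ℕ,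
    (∀ i, 1 ≤ p i) → (∀ i, p i + 1 ≤ 2 * s) → (∀ i k, i < k → p i + 2 ≤ p k) →
    Set.ncard {w : List Bool | w.length = 2 * s ∧ IsDyckList w ∧
      ∀ i : Fin j, w[p i - 1]? = some true ∧ w[p i]? = some false} = catalan (s - j) := by
  induction j with
  | zero =>
    intro s _ p _ _ _
    simpa using ncard_isDyckList s
  | succ j ih =>
    intro s hjs p hlow hhigh hgap
    obtain ⟨s, rfl⟩ : ∃ t, s = t + 1 := ⟨s - 1, by omega⟩
    obtain ⟨q, hq⟩ : ∃ q, p (Fin.last j) = q + 1 := ⟨p (Fin.last j) - 1, by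
      have := hlow (Fin.last j)
      omega⟩
    have hqs : q ≤ 2 * s := by
      have := hhigh (Fin.last j)
      omega
    have hlt : ∀ i : Fin j, p i.castSucc < q := fun i => by
      have := hgap _ _ (Fin.castSucc_lt_last i)
      omega
    rw [Nat.add_sub_add_right, ← ih s (by omega) (fun i => p i.castSucc) (fun i => hlow _)
      (fun i => by have := hlt i; omega)
      (fun i k hik => hgap _ _ (Fin.castSucc_lt_castSucc_iff.2 hik))]
    refine Eq.trans ?_ (Set.ncard_image_of_injective _ (insertNesting_injective q))
    congr 1
    ext w
    simp only [Set.mem_image, Set.mem_ofPred_eq, Fin.forall_fin_succ', hq, Nat.add_sub_cancel]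
    have step : ∀ v : List Bool, v.length = 2 * s → ∀ i : Fin j,
        (insertNesting q v)[p i.castSucc - 1]? = v[p i.castSucc - 1]? ∧
        (insertNesting q v)[p i.castSucc]? = v[p i.castSucc]? := fun v hv i =>
      ⟨getElem?_insertNesting_of_lt (by omega) (by have := hlt i; omega),
        getElem?_insertNesting_of_lt (by omega) (hlt i)⟩
    constructor
    · rintro ⟨hl, hd, hp, ht, hf⟩
      obtain ⟨v, rfl⟩ := exists_insertNesting_eq ht hf
      rw [length_insertNesting] at hl
      have hv : v.length = 2 * s := by omega
      refine ⟨v, ⟨hv, (isDyckList_insertNesting_iff q v).1 hd, fun i => ?_⟩, rfl⟩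
      rw [← (step v hv i).1, ← (step v hv i).2]
      exact hp i
    · rintro ⟨v, ⟨hv, hd, hp⟩, rfl⟩
      refine ⟨by rw [length_insertNesting]; omega, (isDyckList_insertNesting_iff q v).2 hd,
        fun i => ?_, getElem?_insertNesting_self (by omega),
        getElem?_insertNesting_succ (by omega)⟩
      rw [(step v hv i).1, (step v hv i).2]
      exact hp i

/-- Let `s ≥ 1`, `1 ≤ j ≤ s`, and let `p 0 < p 1 < ⋯ < p (j-1)` be
positions (1-indexed) with `1 ≤ p i`, `p i + 1 ≤ 2s`, and consecutive positions at
distance at least `2`. Then the number of Dyck words of semilength `s` having `'('`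
at position `p i` and `')'` at position `p i + 1` for every `i` equals the Catalan
number `C (s - j)`. -/
theorem dyck_words_with_fixed_nestings (s j : ℕ) (hs : 1 ≤ s) (hj1 : 1 ≤ j)
    (hjs : j ≤ s) (p : Fin j → ℕ) (hmono : StrictMono p)
    (hlow : ∀ i, 1 ≤ p i) (hhigh : ∀ i, p i + 1 ≤ 2 * s)
    (hgap : ∀ i : Fin j, ∀ h : i.val + 1 < j, p i + 2 ≤ p ⟨i.val + 1, h⟩) :
    Set.ncard {w : List Bool | w.length = 2 * s ∧ IsDyckList w ∧
      ∀ i : Fin j, w[p i - 1]? = some true ∧ w[p i]? = some false}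
      = catalan (s - j) := by
  refine ncard_isDyckList_with_nestings j s hjs p hlow hhigh fun i k hik => ?_
  have h : i.val + 1 < j := by omega
  exact (hgap i h).trans (hmono.monotone (Fin.mk_le_of_le_val hik))
end

section
/- Define E : ℕ → ℤ by E(s) = Σ_{m=0}^{s} (−1)^m · choose(2s − m − 1, m) · (C_{s−m})². Then for every s ≥ 1, P_0(s)·E(s) + P_1(s)·E(s+1) + P_2(s)·E(s+2) + P_3(s)·E(s+3) = 0, where P_0(s) = 2s³ + s² − 8s + 5, P_1(s) = −26s³ − 93s² − 82s − 30, P_2(s) = −26s³ − 141s² − 226s − 81, and P_3(s) = 2s³ + 17s² + 40s + 16. -/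
/-- `E s = ∑_{m=0}^{s} (-1)^m * choose(2s - m - 1, m) * (C_{s-m})²`, the number of
`(1, 2s-1)`-meander graphs with no pierced circles. `C_n` is the `n`-th Catalan
number. -/
def meanderE (s : ℕ) : ℤ :=
  ∑ m ∈ Finset.range (s + 1),
    (-1 : ℤ) ^ m * ((2 * s - m - 1).choose m : ℤ) * (catalan (s - m) : ℤ) ^ 2

/-- The summand of `meanderE s`, up to the sign `(-1) ^ (s + 1)`, reindexed by `j = s - m - 1`. -/
def meanderTerm (s j : ℕ) : ℚ :=
  (-1) ^ j * ((s + j).choose (2 * j + 1) : ℚ) * (catalan (j + 1) : ℚ) ^ 2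

theorem meanderE_eq_sum_range (s : ℕ) (hs : 1 ≤ s) :
    (meanderE s : ℚ) = (-1) ^ (s + 1) * ∑ j ∈ Finset.range s, meanderTerm s j := by
  obtain ⟨n, rfl⟩ := Nat.exists_eq_add_of_le' hs
  rw [meanderE, Finset.sum_range_succ, Nat.choose_eq_zero_of_lt (by omega), Nat.cast_zero,
    mul_zero, zero_mul, add_zero, ← Finset.sum_range_reflect]
  push_cast
  rw [Finset.mul_sum]
  refine Finset.sum_congr rfl fun j hj => ?_
  have hj : j ≤ n := Nat.lt_succ_iff.mp (Finset.mem_range.mp hj)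
  obtain ⟨d, rfl⟩ := Nat.exists_eq_add_of_le hj
  have hchoose : (j + d + 1 + j).choose d = (j + d + 1 + j).choose (2 * j + 1) :=
    Nat.choose_symm_of_eq_add (by omega)
  rw [meanderTerm, show j + d - j = d by omega,
    show 2 * (j + d + 1) - d - 1 = j + d + 1 + j by omega,
    show j + d + 1 - d = j + 1 by omega, hchoose]
  have hsign : (-1 : ℚ) ^ (j + d + 1 + 1) * (-1) ^ j = (-1) ^ d := by
    rw [← pow_add, show j + d + 1 + 1 + j = d + 2 * (j + 1) by omega, pow_add, pow_mul]
    simp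
  rw [← hsign]
  ring

theorem meanderE_eq_sum_range_of_le {s N : ℕ} (hs : 1 ≤ s) (hN : s ≤ N) :
    (meanderE s : ℚ) = (-1) ^ (s + 1) * ∑ j ∈ Finset.range N, meanderTerm s j := by
  rw [meanderE_eq_sum_range s hs]
  congr 1
  refine Finset.sum_subset (Finset.range_subset_range.mpr hN) fun j _ hj => ?_
  have hj : s ≤ j := by simpa using hj
  simp [meanderTerm, Nat.choose_eq_zero_of_lt (show s + j < 2 * j + 1 by omega)]

theorem cast_choose_eq_succ_choose_mul_div (n k : ℕ) :
    (n.choose k : ℚ) = ((n + 1).choose k : ℚ) * (n + 1 - k) / (n + 1) := by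
  rw [eq_div_iff (by positivity)]
  rcases Nat.le_or_ge k (n + 1) with h | h
  · have := congrArg (Nat.cast (R := ℚ)) (Nat.choose_mul_succ_eq n k)
    push_cast [h] at this
    exact this
  · rcases h.eq_or_lt with rfl | h
    · simp
    · simp [Nat.choose_eq_zero_of_lt h, Nat.choose_eq_zero_of_lt (Nat.lt_of_succ_lt h)]

theorem cast_succ_choose_add_two (n k : ℕ) :
    ((n + 1).choose (k + 2) : ℚ) =
      (n.choose k : ℚ) * (n + 1) * (n - k) / ((k + 1) * (k + 2)) := by
  rw [eq_div_iff (by positivity)]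
  have h₁ : ((n + 1 : ℚ)) * n.choose (k + 1) = (n + 1).choose (k + 2) * (k + 2) := by
    exact_mod_cast Nat.add_one_mul_choose_eq n (k + 1)
  have h₂ : (n.choose (k + 1) : ℚ) * (k + 1) = n.choose k * (n - k) := by
    rcases Nat.le_or_ge k n with h | h
    · have := congrArg (Nat.cast (R := ℚ)) (Nat.choose_succ_right_eq n k)
      push_cast [h] at this
      exact this
    · rcases h.eq_or_lt with rfl | h
      · simp
      · simp [Nat.choose_eq_zero_of_lt h, Nat.choose_eq_zero_of_lt (Nat.lt_succ_of_lt h)]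
  linear_combination (-(k + 1 : ℚ)) * h₁ + (n + 1 : ℚ) * h₂

theorem cast_catalan_succ (n : ℕ) :
    (catalan (n + 1) : ℚ) = 2 * (2 * n + 1) * catalan n / (n + 2) := by
  have h (m : ℕ) : ((m : ℚ) + 1) * catalan m = m.centralBinom := by
    exact_mod_cast succ_mul_catalan_eq_centralBinom m
  have hc : ((n : ℚ) + 1) * (n + 1).centralBinom = 2 * (2 * n + 1) * n.centralBinom := by
    exact_mod_cast Nat.succ_mul_centralBinom_succ n
  have hn := h n
  have hn' := h (n + 1)
  push_cast at hn'
  rw [eq_div_iff (by positivity)]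
  have hpos : (n + 1 : ℚ) ≠ 0 := by positivity
  refine mul_left_cancel₀ hpos ?_
  linear_combination (n + 1 : ℚ) * hn' + hc - 2 * (2 * n + 1 : ℚ) * hn

/-- The Wilf–Zeilberger companion of `meanderTerm`. -/
def meanderCertificate (s j : ℕ) : ℚ :=
  (16 * s ^ 3 + 72 * s ^ 2 + 92 * s + 30) * j * (j + 2) ^ 2 /
    ((s + j + 1) * (s + j + 2) * (s + j + 3)) * meanderTerm (s + 3) j

theorem meanderCertificate_succ_sub (s j : ℕ) :
    meanderCertificate s (j + 1) - meanderCertificate s j =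
      (2 * (s : ℚ) ^ 3 + (s : ℚ) ^ 2 - 8 * s + 5) * meanderTerm s j
      - (-26 * (s : ℚ) ^ 3 - 93 * (s : ℚ) ^ 2 - 82 * s - 30) * meanderTerm (s + 1) j
      + (-26 * (s : ℚ) ^ 3 - 141 * (s : ℚ) ^ 2 - 226 * s - 81) * meanderTerm (s + 2) j
      - (2 * (s : ℚ) ^ 3 + 17 * (s : ℚ) ^ 2 + 40 * s + 16) * meanderTerm (s + 3) j := by
  have h₀ := cast_choose_eq_succ_choose_mul_div (s + j) (2 * j + 1)
  have h₁ := cast_choose_eq_succ_choose_mul_div (s + j + 1) (2 * j + 1)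
  have h₂ := cast_choose_eq_succ_choose_mul_div (s + j + 2) (2 * j + 1)
  have h₃ := cast_succ_choose_add_two (s + j + 3) (2 * j + 1)
  have hc := cast_catalan_succ (j + 1)
  simp only [meanderCertificate, meanderTerm, show s + 1 + j = s + j + 1 by omega,
    show s + 2 + j = s + j + 2 by omega, show s + 3 + j = s + j + 3 by omega,
    show s + 3 + (j + 1) = s + j + 3 + 1 by omega,
    show 2 * (j + 1) + 1 = 2 * j + 1 + 2 by omega]
  rw [h₀, h₁, h₂, h₃, hc]
  push_cast
  rw [pow_succ (-1 : ℚ) j]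
  generalize (-1 : ℚ) ^ j = e
  generalize ((s + j + 2 + 1).choose (2 * j + 1) : ℚ) = t
  generalize (catalan (j + 1) : ℚ) = c
  field_simp
  ring

theorem meanderCertificate_zero (s : ℕ) : meanderCertificate s 0 = 0 := by
  simp [meanderCertificate]

theorem meanderCertificate_add_three (s : ℕ) : meanderCertificate s (s + 3) = 0 := by
  simp [meanderCertificate, meanderTerm,
    Nat.choose_eq_zero_of_lt (show s + 3 + (s + 3) < 2 * (s + 3) + 1 by omega)]

/-- Zeilberger recurrence. For every `s ≥ 1`,
`P₀(s)·E(s) + P₁(s)·E(s+1) + P₂(s)·E(s+2) + P₃(s)·E(s+3) = 0`, where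
`P₀(s) = 2s³ + s² - 8s + 5`, `P₁(s) = -26s³ - 93s² - 82s - 30`,
`P₂(s) = -26s³ - 141s² - 226s - 81`, `P₃(s) = 2s³ + 17s² + 40s + 16`. -/
theorem meanderE_recurrence (s : ℕ) (hs : 1 ≤ s) :
    (2 * (s : ℤ) ^ 3 + (s : ℤ) ^ 2 - 8 * s + 5) * meanderE s
      + (-26 * (s : ℤ) ^ 3 - 93 * (s : ℤ) ^ 2 - 82 * s - 30) * meanderE (s + 1)
      + (-26 * (s : ℤ) ^ 3 - 141 * (s : ℤ) ^ 2 - 226 * s - 81) * meanderE (s + 2)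
      + (2 * (s : ℤ) ^ 3 + 17 * (s : ℤ) ^ 2 + 40 * s + 16) * meanderE (s + 3) = 0 := by
  have hsum := Finset.sum_range_sub (meanderCertificate s) (s + 3)
  simp only [meanderCertificate_succ_sub, meanderCertificate_zero, meanderCertificate_add_three,
    Finset.sum_add_distrib, Finset.sum_sub_distrib, ← Finset.mul_sum] at hsum
  rw [← Int.cast_inj (α := ℚ)]
  push_cast
  rw [meanderE_eq_sum_range_of_le hs (show s ≤ s + 3 by omega),
    meanderE_eq_sum_range_of_le (show 1 ≤ s + 1 by omega) (show s + 1 ≤ s + 3 by omega),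
    meanderE_eq_sum_range_of_le (show 1 ≤ s + 2 by omega) (show s + 2 ≤ s + 3 by omega),
    meanderE_eq_sum_range_of_le (show 1 ≤ s + 3 by omega) le_rfl]
  linear_combination (-1 : ℚ) ^ (s + 1) * hsum
end

section
/- Define E : ℕ → ℤ by E(s) = Σ_{m=0}^{s} (−1)^m · choose(2s − m − 1, m) · (C_{s−m})². Then the real sequence E(s)/(C_s)² tends to 0 as s → ∞. -/
open Filter

/-- The polynomial `∑_m (-1)^m * choose(2s - m - 1, m) * w^(s-m)`, from which `meanderE s` arises
on replacing each power `w^n` by the squared Catalan number `C_n²`. -/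
noncomputable def meanderPoly (s : ℕ) (w : ℝ) : ℝ :=
  ∑ m ∈ Finset.range (s + 1), (-1) ^ m * ((2 * s - m - 1).choose m : ℝ) * w ^ (s - m)

/-- The companion of `meanderPoly` with binomial coefficients `choose(2s - m, m)`. -/
noncomputable def meanderPolyAux (s : ℕ) (w : ℝ) : ℝ :=
  ∑ m ∈ Finset.range (s + 1), (-1) ^ m * ((2 * s - m).choose m : ℝ) * w ^ (s - m)

theorem meanderPolyAux_succ (s : ℕ) (w : ℝ) :
    meanderPolyAux (s + 1) w = meanderPoly (s + 1) w - meanderPolyAux s w := by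
  unfold meanderPolyAux meanderPoly
  rw [Finset.sum_range_succ' _ (s + 1), Finset.sum_range_succ' _ (s + 1), add_sub_right_comm,
    ← Finset.sum_sub_distrib]
  congr 1
  · refine Finset.sum_congr rfl fun m hm => ?_
    have hm' : m ≤ s := Nat.lt_succ_iff.mp (Finset.mem_range.mp hm)
    have h1 : 2 * (s + 1) - (m + 1) = (2 * s - m) + 1 := by omega
    have h2 : 2 * (s + 1) - (m + 1) - 1 = 2 * s - m := by omega
    have h3 : s + 1 - (m + 1) = s - m := by omega
    rw [h2, h1, h3, Nat.choose_succ_succ]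
    push_cast
    ring

theorem meanderPoly_add_two (s : ℕ) (w : ℝ) :
    meanderPoly (s + 2) w = w * meanderPolyAux (s + 1) w - meanderPoly (s + 1) w := by
  have hA : w * meanderPolyAux (s + 1) w = ∑ m ∈ Finset.range (s + 3),
      (-1) ^ m * ((2 * (s + 1) - m).choose m : ℝ) * w ^ (s + 2 - m) := by
    rw [Finset.sum_range_succ, Nat.choose_eq_zero_of_lt (by omega : 2 * (s + 1) - (s + 2) < s + 2)]
    simp only [Nat.cast_zero, mul_zero, zero_mul, add_zero, meanderPolyAux, Finset.mul_sum]
    refine Finset.sum_congr rfl fun m hm => ?_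
    have hm' : m ≤ s + 1 := Nat.lt_succ_iff.mp (Finset.mem_range.mp hm)
    rw [show s + 2 - m = (s + 1 - m) + 1 by omega, pow_succ]
    ring
  rw [hA]
  unfold meanderPoly
  rw [Finset.sum_range_succ' _ (s + 2), Finset.sum_range_succ' _ (s + 2), add_sub_right_comm,
    ← Finset.sum_sub_distrib]
  congr 1
  · refine Finset.sum_congr rfl fun m hm => ?_
    have hm' : m ≤ s + 1 := Nat.lt_succ_iff.mp (Finset.mem_range.mp hm)
    have h1 : 2 * (s + 2) - (m + 1) - 1 = (2 * (s + 1) - m - 1) + 1 := by omega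
    have h2 : 2 * (s + 1) - (m + 1) = 2 * (s + 1) - m - 1 := by omega
    have h3 : s + 2 - (m + 1) = s + 1 - m := by omega
    rw [h1, h2, h3, Nat.choose_succ_succ]
    push_cast
    ring

theorem meanderPoly_one (w : ℝ) : meanderPoly 1 w = w := by
  simp [meanderPoly, Finset.sum_range_succ]

theorem meanderPoly_two (w : ℝ) : meanderPoly 2 w = w ^ 2 - 2 * w := by
  simp [meanderPoly, Finset.sum_range_succ]
  ring

theorem meanderPoly_add_three (s : ℕ) (w : ℝ) :
    meanderPoly (s + 3) w = (w - 2) * meanderPoly (s + 2) w - meanderPoly (s + 1) w := by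
  have h1 := meanderPoly_add_two (s + 1) w
  have h2 := meanderPoly_add_two s w
  have h3 := meanderPolyAux_succ (s + 1) w
  linear_combination h1 + w * h3 + h2

theorem abs_meanderPoly_succ_le {w : ℝ} (hw0 : 0 ≤ w) (hw : w ≤ 16) (s : ℕ) :
    |meanderPoly (s + 1) w| ≤ 16 * 15 ^ s := by
  have hw2 : |w - 2| ≤ 14 := abs_le.mpr ⟨by linarith, by linarith⟩
  have key : |meanderPoly (s + 1) w| ≤ 16 * 15 ^ s ∧
      |meanderPoly (s + 2) w| ≤ 16 * 15 ^ (s + 1) := by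
    induction s with
    | zero =>
      rw [meanderPoly_one, meanderPoly_two]
      refine ⟨by rw [abs_of_nonneg hw0]; linarith, abs_le.mpr ?_⟩
      constructor <;> norm_num <;> nlinarith
    | succ s ih =>
      refine ⟨ih.2, ?_⟩
      rw [meanderPoly_add_three]
      calc |(w - 2) * meanderPoly (s + 2) w - meanderPoly (s + 1) w|
          ≤ |w - 2| * |meanderPoly (s + 2) w| + |meanderPoly (s + 1) w| := by
            rw [← abs_mul]
            exact abs_sub _ _
        _ ≤ 14 * (16 * 15 ^ (s + 1)) + 16 * 15 ^ s := by
            gcongr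
            exacts [ih.2, ih.1]
        _ ≤ 16 * 15 ^ (s + 1 + 1) := by
            have : (0 : ℝ) < 15 ^ s := by positivity
            rw [pow_succ _ (s + 1), pow_succ]
            linarith
  exact key.1

theorem integral_sin_pow_even_eq_centralBinom (n : ℕ) :
    ∫ x in (0 : ℝ)..Real.pi, Real.sin x ^ (2 * n) = Real.pi * (n.centralBinom / 4 ^ n) := by
  rw [integral_sin_pow_even]
  congr 1
  induction n with
  | zero => simp
  | succ n ih =>
    rw [Finset.prod_range_succ, ih]
    have h : ((n : ℝ) + 1) * (n + 1).centralBinom = 2 * (2 * n + 1) * n.centralBinom := by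
      exact_mod_cast Nat.succ_mul_centralBinom_succ n
    rw [pow_succ]
    field_simp
    linear_combination -2 * h

/-- The moments of the semicircle law, in trigonometric form. -/
theorem integral_four_mul_sin_sq_pow_mul_cos_sq (n : ℕ) :
    ∫ x in (0 : ℝ)..Real.pi, (4 * Real.sin x ^ 2) ^ n * Real.cos x ^ 2
      = Real.pi / 2 * catalan n := by
  have hint (k : ℕ) : IntervalIntegrable (fun x => Real.sin x ^ (2 * k)) MeasureTheory.volume
      0 Real.pi := (by fun_prop : Continuous _).intervalIntegrable _ _
  have hf (x : ℝ) : (4 * Real.sin x ^ 2) ^ n * Real.cos x ^ 2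
      = 4 ^ n * (Real.sin x ^ (2 * n) - Real.sin x ^ (2 * (n + 1))) := by
    rw [Real.cos_sq']
    ring
  simp_rw [hf]
  rw [intervalIntegral.integral_const_mul, intervalIntegral.integral_sub (hint n) (hint (n + 1)),
    integral_sin_pow_even_eq_centralBinom, integral_sin_pow_even_eq_centralBinom]
  have h1 : ((n : ℝ) + 1) * (n + 1).centralBinom = 2 * (2 * n + 1) * n.centralBinom := by
    exact_mod_cast Nat.succ_mul_centralBinom_succ n
  have h2 : ((n : ℝ) + 1) * catalan n = n.centralBinom := by
    exact_mod_cast succ_mul_catalan_eq_centralBinom n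
  have hn : (n : ℝ) + 1 ≠ 0 := by positivity
  rw [← h2] at h1 ⊢
  have h3 : ((n + 1).centralBinom : ℝ) = 2 * (2 * n + 1) * catalan n :=
    mul_left_cancel₀ hn (by linear_combination h1)
  rw [h3]
  field_simp
  ring

/-- Multiplying the coefficients of a polynomial by Catalan numbers does not increase its
supremum, provided the interval is shrunk by a factor of four. -/
theorem abs_sum_mul_catalan_mul_pow_le {ι : Type*} (I : Finset ι) (a : ι → ℝ) (e : ι → ℕ)
    {R B : ℝ} (h : ∀ w, 0 ≤ w → w ≤ 4 * R → |∑ i ∈ I, a i * w ^ e i| ≤ B)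
    {w : ℝ} (hw0 : 0 ≤ w) (hw : w ≤ R) :
    |∑ i ∈ I, a i * catalan (e i) * w ^ e i| ≤ B := by
  have hcos : ∫ x in (0 : ℝ)..Real.pi, Real.cos x ^ 2 = Real.pi / 2 := by
    simpa [-integral_cos_sq] using integral_four_mul_sin_sq_pow_mul_cos_sq 0
  have hsum : Real.pi / 2 * ∑ i ∈ I, a i * catalan (e i) * w ^ e i
      = ∫ x in (0 : ℝ)..Real.pi,
        (∑ i ∈ I, a i * (4 * Real.sin x ^ 2 * w) ^ e i) * Real.cos x ^ 2 := by
    simp_rw [Finset.sum_mul]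
    rw [intervalIntegral.integral_finsetSum fun i _ =>
      (by fun_prop : Continuous _).intervalIntegrable _ _, Finset.mul_sum]
    refine Finset.sum_congr rfl fun i _ => ?_
    rw [show Real.pi / 2 * (a i * catalan (e i) * w ^ e i)
      = a i * w ^ e i * (Real.pi / 2 * catalan (e i)) by ring,
      ← integral_four_mul_sin_sq_pow_mul_cos_sq, ← intervalIntegral.integral_const_mul]
    congr 1
    ext x
    rw [mul_pow _ w]
    ring
  have hbound : |Real.pi / 2 * ∑ i ∈ I, a i * catalan (e i) * w ^ e i| ≤ Real.pi / 2 * B := by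
    rw [hsum, ← hcos, mul_comm _ B, ← intervalIntegral.integral_const_mul, ← Real.norm_eq_abs]
    refine intervalIntegral.norm_integral_le_of_norm_le Real.pi_pos.le
      (MeasureTheory.ae_of_all _ fun x _ => ?_) ((by fun_prop : Continuous _).intervalIntegrable _ _)
    rw [norm_mul, Real.norm_of_nonneg (sq_nonneg (Real.cos x)), Real.norm_eq_abs]
    refine mul_le_mul_of_nonneg_right (h _ (by positivity) ?_) (sq_nonneg _)
    nlinarith [Real.sin_sq_le_one x, sq_nonneg (Real.sin x)]
  have hpi : 0 < Real.pi / 2 := by positivity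
  rw [abs_mul, abs_of_pos hpi] at hbound
  exact le_of_mul_le_mul_left hbound hpi

theorem abs_meanderE_succ_le (s : ℕ) : |(meanderE (s + 1) : ℝ)| ≤ 16 * 15 ^ s := by
  have h1 (w : ℝ) (hw0 : 0 ≤ w) (hw : w ≤ 4 * 1) := abs_sum_mul_catalan_mul_pow_le
    (Finset.range (s + 1 + 1)) (fun m => (-1) ^ m * ((2 * (s + 1) - m - 1).choose m : ℝ))
    (fun m => s + 1 - m) (R := 4)
    (fun w hw0 hw => abs_meanderPoly_succ_le hw0 (by linarith) s) hw0 (by linarith)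
  have h2 := abs_sum_mul_catalan_mul_pow_le _ _ _ h1 zero_le_one le_rfl
  convert h2 using 2
  simp only [meanderE, Int.cast_sum]
  refine Finset.sum_congr rfl fun m _ => ?_
  push_cast
  ring

theorem four_pow_le_mul_catalan (s : ℕ) :
    (4 : ℝ) ^ (s + 1) ≤ 2 * (s + 2) ^ 2 * catalan (s + 1) := by
  have h1 : (4 : ℝ) ^ (s + 1) ≤ 2 * (s + 1) * (s + 1).centralBinom := by
    exact_mod_cast Nat.four_pow_le_two_mul_self_mul_centralBinom (s + 1) s.succ_pos
  have h2 : ((s : ℝ) + 1 + 1) * catalan (s + 1) = (s + 1).centralBinom := by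
    exact_mod_cast succ_mul_catalan_eq_centralBinom (s + 1)
  rw [← h2] at h1
  have h3 : (0 : ℝ) ≤ (s + 2) * catalan (s + 1) := by positivity
  linarith

/-- The ratio `E s / C_s²` of meander graphs without a pierced circle
to all meander graphs tends to `0` as `s → ∞`. -/
theorem pierced_circles_ratio_tendsto_zero :
    Tendsto (fun s : ℕ => (meanderE s : ℝ) / (catalan s : ℝ) ^ 2) atTop (nhds 0) := by
  rw [← tendsto_add_atTop_iff_nat 1]
  have hlim : Tendsto (fun s : ℕ => 4 * (15 / 16) ^ (-2 : ℤ) *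
      (((s + 2 : ℕ) : ℝ) ^ 4 * (15 / 16) ^ (s + 2))) atTop (nhds 0) := by
    have := ((tendsto_pow_const_mul_const_pow_of_abs_lt_one 4
      (show |(15 / 16 : ℝ)| < 1 by norm_num [abs_of_pos])).comp
      (tendsto_add_atTop_nat 2)).const_mul (4 * (15 / 16 : ℝ) ^ (-2 : ℤ))
    simpa only [mul_zero, Function.comp_def] using this
  refine squeeze_zero_norm (fun s => ?_) hlim
  have hcat := four_pow_le_mul_catalan s
  have hpos : (0 : ℝ) < catalan (s + 1) := by
    by_contra! h0
    have h4 : (0 : ℝ) < 4 ^ (s + 1) := by positivity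
    nlinarith [sq_nonneg ((s : ℝ) + 2)]
  have hsq : (16 : ℝ) ^ (s + 1) ≤ 4 * (s + 2) ^ 4 * (catalan (s + 1) : ℝ) ^ 2 := by
    calc (16 : ℝ) ^ (s + 1) = (4 ^ (s + 1)) ^ 2 := by
          rw [← pow_mul, mul_comm, pow_mul]
          norm_num
      _ ≤ (2 * (s + 2) ^ 2 * catalan (s + 1)) ^ 2 := by gcongr
      _ = _ := by ring
  rw [norm_div, norm_pow, Real.norm_of_nonneg hpos.le, Real.norm_eq_abs, div_le_iff₀ (by positivity)]
  calc |(meanderE (s + 1) : ℝ)| ≤ 16 * 15 ^ s := abs_meanderE_succ_le s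
    _ = (15 / 16) ^ s * 16 ^ (s + 1) := by
        rw [div_pow, pow_succ]
        field_simp
    _ ≤ (15 / 16) ^ s * (4 * (s + 2) ^ 4 * (catalan (s + 1) : ℝ) ^ 2) := by gcongr
    _ = _ := by
        rw [pow_add _ s 2]
        push_cast
        norm_num
        ring
end

section
/- Let O : ℕ → ℤ be any function and let k ≤ s be natural numbers. Then Σ_{m=k+1}^{s} choose(m, k) · ( Σ_{j=m}^{s} (−1)^{m+j} choose(j, m) O(j) ) = Σ_{m=k+1}^{s} O(m) · choose(m, k) · ( Σ_{i=k+1}^{m} (−1)^{m−i} choose(m − k, m − i) ). -/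
theorem Nat.choose_mul_choose_eq_choose_mul_choose_sub {k i m : ℕ} (hki : k ≤ i) (him : i ≤ m) :
    i.choose k * m.choose i = m.choose k * (m - k).choose (m - i) := by
  rw [mul_comm, Nat.choose_mul hki, ← Nat.choose_symm (show i - k ≤ m - k by lia)]
  congr 2
  lia


/-- double-sum rearrangement, Claim 7.1 of the paper. For any
`O : ℕ → ℤ` and natural numbers `k ≤ s`,
`∑_{m=k+1}^{s} choose(m,k) (∑_{j=m}^{s} (-1)^(m+j) choose(j,m) O j)
  = ∑_{m=k+1}^{s} O m * choose(m,k) * (∑_{i=k+1}^{m} (-1)^(m-i) choose(m-k, m-i))`. -/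
theorem double_sum_rearrangement (O : ℕ → ℤ) (k s : ℕ) (hks : k ≤ s) :
    ∑ m ∈ Finset.Icc (k + 1) s, (m.choose k : ℤ) *
        (∑ j ∈ Finset.Icc m s, (-1 : ℤ) ^ (m + j) * (j.choose m : ℤ) * O j)
      = ∑ m ∈ Finset.Icc (k + 1) s, O m * (m.choose k : ℤ) *
        (∑ i ∈ Finset.Icc (k + 1) m, (-1 : ℤ) ^ (m - i) * ((m - k).choose (m - i) : ℤ)) := by
  simp_rw [Finset.mul_sum]
  rw [Finset.sum_comm' (t' := Finset.Icc (k + 1) s) (s' := fun j => Finset.Icc (k + 1) j)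
    (by simp only [Finset.mem_Icc]; lia)]
  refine Finset.sum_congr rfl fun m _ => Finset.sum_congr rfl fun i hi => ?_
  obtain ⟨hki, him⟩ := Finset.mem_Icc.mp hi
  have hchoose : (i.choose k : ℤ) * m.choose i = m.choose k * (m - k).choose (m - i) :=
    mod_cast Nat.choose_mul_choose_eq_choose_mul_choose_sub (by lia) him
  have hsign : (-1 : ℤ) ^ (i + m) = (-1) ^ (m - i) := by
    rw [show i + m = m - i + 2 * i by lia, pow_add, pow_mul]
    simp
  rw [hsign]
  linear_combination (-1) ^ (m - i) * O m * hchoose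
end

section
/- For every natural number n ≥ 1, 2·Σ_{k=1}^{n} k·choose(n, k)·choose(n, k−1) = n·(n + 1)·C_n; equivalently, Σ_{k=1}^{n} k·N(n, k) = ((n + 1)/2)·C_n, so the expected number of nestings in a uniformly random Dyck word of semilength n is (n + 1)/2. -/
/-- A case of Vandermonde's identity. -/
theorem sum_range_choose_mul_choose_succ (m : ℕ) :
    ∑ j ∈ Finset.range (m + 1), m.choose j * (m + 1).choose j = (2 * m + 1).choose m := by
  rw [show 2 * m + 1 = (m + 1) + m by ring, Nat.add_choose_eq,
    Finset.Nat.sum_antidiagonal_eq_sum_range_succ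
      (fun i j => (m + 1).choose i * m.choose j)]
  refine Finset.sum_congr rfl fun j hj => ?_
  rw [Nat.choose_symm (Finset.mem_range_succ_iff.mp hj), mul_comm]

theorem two_mul_choose_two_mul_add_one (m : ℕ) :
    2 * (2 * m + 1).choose m = (m + 2) * catalan (m + 1) := by
  rw [succ_mul_catalan_eq_centralBinom (m + 1), Nat.centralBinom_eq_two_mul_choose, mul_add_one,
    Nat.choose_succ_succ, Nat.choose_symm_half, two_mul]

theorem two_mul_sum_mul_choose_mul_choose_pred (n : ℕ) :
    2 * ∑ k ∈ Finset.Icc 1 n, k * (n.choose k * n.choose (k - 1))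
      = n * (n + 1) * catalan n := by
  cases n with
  | zero => simp
  | succ m =>
    have h : ∑ k ∈ Finset.Icc 1 (m + 1), k * ((m + 1).choose k * (m + 1).choose (k - 1))
        = (m + 1) * (2 * m + 1).choose m := by
      rw [← sum_range_choose_mul_choose_succ, Finset.mul_sum, Finset.range_eq_Ico,
        ← Finset.Ico_add_one_right_eq_Icc, ← Finset.sum_Ico_add' _ 0 (m + 1) 1]
      refine Finset.sum_congr rfl fun j _ => ?_
      rw [Nat.add_sub_cancel, ← mul_assoc (m + 1), Nat.add_one_mul_choose_eq]
      ring
    rw [h, mul_left_comm, two_mul_choose_two_mul_add_one]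
    ring

/-- For every `n ≥ 1`,
`2 * ∑_{k=1}^{n} k * choose(n,k) * choose(n,k-1) = n * (n + 1) * C_n`; equivalently,
`∑_{k=1}^{n} k * N(n,k) = ((n + 1)/2) * C_n`, where `N(n,k) = (1/n) choose(n,k)
choose(n,k-1)` is the Narayana number, so the expected number of nestings in a
uniformly random Dyck word of semilength `n` is `(n + 1)/2`. -/
theorem expected_nestings (n : ℕ) (hn : 1 ≤ n) :
    (2 * ∑ k ∈ Finset.Icc 1 n, k * (n.choose k * n.choose (k - 1))
        = n * (n + 1) * catalan n) ∧
    (∑ k ∈ Finset.Icc 1 n,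
        (k : ℚ) * (1 / (n : ℚ) * (n.choose k : ℚ) * (n.choose (k - 1) : ℚ))
      = ((n : ℚ) + 1) / 2 * (catalan n : ℚ)) := by
  have h := two_mul_sum_mul_choose_mul_choose_pred n
  refine ⟨h, ?_⟩
  have hn0 : (n : ℚ) ≠ 0 := by positivity
  have hq : (2 : ℚ) * ∑ k ∈ Finset.Icc 1 n, (k : ℚ) * (n.choose k * n.choose (k - 1))
      = n * (n + 1) * catalan n := by exact_mod_cast h
  have hs : ∑ k ∈ Finset.Icc 1 n,
        (k : ℚ) * (1 / (n : ℚ) * (n.choose k : ℚ) * (n.choose (k - 1) : ℚ))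
      = 1 / n * ∑ k ∈ Finset.Icc 1 n, (k : ℚ) * (n.choose k * n.choose (k - 1)) := by
    rw [Finset.mul_sum]
    exact Finset.sum_congr rfl fun k _ => by ring
  rw [hs, eq_div_of_mul_eq two_ne_zero ((mul_comm _ _).trans hq)]
  field_simp
end

section
/- For every natural number s ≥ 1, the sum over all ordered pairs (P, Q) of Dyck words of semilength s of (number of nestings of P) + (number of nestings of Q) equals (s + 1)·(C_s)². -/
/-- The number of nestings of a word: occurrences of a `'('` immediately followed
by a `')'`. -/
def nestingCount (w : List Bool) : ℕ :=
  (w.zip w.tail).count (true, false)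

open BinaryTree DyckWord

/-- The parenthesis word of a binary tree: the left subtree of the root is put inside the
first pair of parentheses, the right subtree after it. -/
def treeWord (t : BinaryTree Unit) : List Bool :=
  (ofTree t).toList.map (fun x => decide (x = DyckStep.U))

/-- The number of nodes of a binary tree whose left subtree is empty. -/
def leftNilCount : BinaryTree Unit → ℕ
  | .nil => 0
  | .node _ l r => (if l = .nil then 1 else 0) + leftNilCount l + leftNilCount r

/-- The mirror image of a binary tree. -/
def treeMirror : BinaryTree Unit → BinaryTree Unit
  | .nil => .nil
  | .node x l r => .node x (treeMirror r) (treeMirror l)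

lemma treeMirror_treeMirror (t : BinaryTree Unit) : treeMirror (treeMirror t) = t := by
  induction t with
  | nil => rfl
  | node x l r hl hr => simp [treeMirror, hl, hr]

lemma numNodes_treeMirror (t : BinaryTree Unit) : (treeMirror t).numNodes = t.numNodes := by
  induction t with
  | nil => rfl
  | node x l r hl hr => simp [treeMirror, BinaryTree.numNodes, hl, hr]; omega

lemma treeMirror_eq_nil {t : BinaryTree Unit} : treeMirror t = .nil ↔ t = .nil := by
  cases t <;> simp [treeMirror]

/-- A nonempty binary tree has one more empty subtree than it has nodes. -/
lemma leftNilCount_add_leftNilCount_treeMirror (t : BinaryTree Unit) :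
    leftNilCount t + leftNilCount (treeMirror t) + (if t = .nil then 1 else 0)
      = t.numNodes + 1 := by
  induction t with
  | nil => rfl
  | node x l r hl hr =>
    simp only [treeMirror, leftNilCount, BinaryTree.numNodes, treeMirror_eq_nil, reduceCtorEq,
      if_false]
    omega

lemma sum_leftNilCount {s : ℕ} (hs : 1 ≤ s) :
    2 * ∑ t ∈ treesOfNumNodesEq s, leftNilCount t = (s + 1) * catalan s := by
  have hmirror : ∑ t ∈ treesOfNumNodesEq s, leftNilCount (treeMirror t)
      = ∑ t ∈ treesOfNumNodesEq s, leftNilCount t :=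
    Finset.sum_nbij' treeMirror treeMirror
      (fun t ht => by simpa [mem_treesOfNumNodesEq, numNodes_treeMirror] using ht)
      (fun t ht => by simpa [mem_treesOfNumNodesEq, numNodes_treeMirror] using ht)
      (fun t _ => treeMirror_treeMirror t) (fun t _ => treeMirror_treeMirror t)
      (fun _ _ => rfl)
  have hsum : ∑ t ∈ treesOfNumNodesEq s, (leftNilCount t + leftNilCount (treeMirror t))
      = ∑ _t ∈ treesOfNumNodesEq s, (s + 1) := by
    refine Finset.sum_congr rfl fun t ht => ?_
    rw [mem_treesOfNumNodesEq] at ht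
    have h := leftNilCount_add_leftNilCount_treeMirror t
    have hne : t ≠ .nil := by
      rintro rfl
      simp [BinaryTree.numNodes] at ht
      omega
    rw [if_neg hne, ht] at h
    exact h
  rw [Finset.sum_add_distrib, hmirror, Finset.sum_const, treesOfNumNodesEq_card_eq_catalan,
    smul_eq_mul] at hsum
  linarith

lemma treeWord_nil : treeWord .nil = [] := rfl

lemma treeWord_node (x : Unit) (l r : BinaryTree Unit) :
    treeWord (.node x l r) = true :: (treeWord l ++ false :: treeWord r) := by
  change List.map _ (([DyckStep.U] ++ (ofTree l).toList ++ [DyckStep.D]) ++ (ofTree r).toList) = _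
  simp [treeWord]

lemma nestingCount_false_cons (w : List Bool) : nestingCount (false :: w) = nestingCount w := by
  cases w <;> simp [nestingCount]

lemma nestingCount_true_true_cons (w : List Bool) :
    nestingCount (true :: true :: w) = nestingCount (true :: w) := by
  simp [nestingCount]

lemma nestingCount_true_false_cons (w : List Bool) :
    nestingCount (true :: false :: w) = nestingCount w + 1 := by
  rw [← nestingCount_false_cons w]
  simp [nestingCount]

lemma nestingCount_treeWord_append (t : BinaryTree Unit) (w : List Bool) :
    nestingCount (treeWord t ++ w) = leftNilCount t + nestingCount w := by
  induction t generalizing w with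
  | nil => simp [treeWord_nil, leftNilCount]
  | node x l r hl hr =>
    have key : nestingCount (true :: (treeWord l ++ false :: (treeWord r ++ w)))
        = (if l = .nil then 1 else 0)
          + nestingCount (treeWord l ++ false :: (treeWord r ++ w)) := by
      cases l with
      | nil => simp [treeWord_nil, nestingCount_true_false_cons, nestingCount_false_cons, add_comm]
      | node y a b => simp [treeWord_node, nestingCount_true_true_cons]
    rw [hl, nestingCount_false_cons, hr] at key
    simp only [treeWord_node, List.cons_append, List.append_assoc, leftNilCount]
    omega

lemma nestingCount_treeWord (t : BinaryTree Unit) :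
    nestingCount (treeWord t) = leftNilCount t := by
  simpa [nestingCount] using nestingCount_treeWord_append t []

lemma dyckStep_decide_injective :
    Function.Injective (fun x : DyckStep => decide (x = DyckStep.U)) := by
  rintro (_ | _) (_ | _) <;> simp

lemma treeWord_injective : Function.Injective treeWord := fun _ _ h =>
  equivTree.symm.injective (DyckWord.ext (dyckStep_decide_injective.list_map h))

lemma count_true_map_decide (l : List DyckStep) :
    (l.map (fun x => decide (x = DyckStep.U))).count true = l.count DyckStep.U :=
  List.count_map_of_injective l _ dyckStep_decide_injective DyckStep.U

lemma count_false_map_decide (l : List DyckStep) :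
    (l.map (fun x => decide (x = DyckStep.U))).count false = l.count DyckStep.D :=
  List.count_map_of_injective l _ dyckStep_decide_injective DyckStep.D

lemma isDyckList_map_decide {l : List DyckStep} :
    IsDyckList (l.map (fun x => decide (x = DyckStep.U))) ↔
      l.count DyckStep.U = l.count DyckStep.D ∧
        ∀ n, (l.take n).count DyckStep.D ≤ (l.take n).count DyckStep.U := by
  simp only [IsDyckList, ← List.map_take, count_true_map_decide, count_false_map_decide]

lemma setOf_isDyckList_eq_image_treeWord (s : ℕ) :
    {w : List Bool | w.length = 2 * s ∧ IsDyckList w}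
      = ((treesOfNumNodesEq s).image treeWord : Finset (List Bool)) := by
  ext w
  simp only [Set.mem_ofPred_eq, Finset.coe_image, Set.mem_image, Finset.mem_coe,
    mem_treesOfNumNodesEq]
  constructor
  · rintro ⟨hlen, hw⟩
    obtain ⟨l, rfl⟩ : ∃ l : List DyckStep, l.map (fun x => decide (x = DyckStep.U)) = w := by
      refine ⟨w.map (fun b => if b then DyckStep.U else DyckStep.D), ?_⟩
      rw [List.map_map]
      exact (List.map_congr_left (by rintro (_ | _) _ <;> rfl)).trans (List.map_id w)
    rw [isDyckList_map_decide] at hw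
    refine ⟨toTree ⟨l, hw.1, hw.2⟩, ?_, by rw [treeWord, ofTree_toTree]⟩
    have h := two_mul_semilength_eq_length (p := ⟨l, hw.1, hw.2⟩)
    rw [List.length_map] at hlen
    rw [numNodes_toTree]
    dsimp only at h
    omega
  · rintro ⟨t, rfl, rfl⟩
    refine ⟨?_, isDyckList_map_decide.2
      ⟨(ofTree t).count_U_eq_count_D, (ofTree t).count_D_le_count_U⟩⟩
    rw [treeWord, List.length_map, ← two_mul_semilength_eq_length, ← numNodes_toTree,
      toTree_ofTree]

lemma finsum_mem_isDyckList (s : ℕ) (f : List Bool → ℕ) :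
    ∑ᶠ w ∈ {w : List Bool | w.length = 2 * s ∧ IsDyckList w}, f w
      = ∑ t ∈ treesOfNumNodesEq s, f (treeWord t) := by
  rw [setOf_isDyckList_eq_image_treeWord, finsum_mem_coe_finset,
    Finset.sum_image treeWord_injective.injOn]

/-- For every `s ≥ 1`, the sum over all ordered pairs `(P, Q)` of
Dyck words of semilength `s` of (number of nestings of `P`) + (number of nestings of
`Q`) equals `(s + 1) * C_s²`, i.e. the expected number of bigons in a random
`(1, 2s-1)`-meander link diagram is `s + 1`. -/
theorem expected_bigons (s : ℕ) (hs : 1 ≤ s) :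
    ∑ᶠ P ∈ {w : List Bool | w.length = 2 * s ∧ IsDyckList w},
      ∑ᶠ Q ∈ {w : List Bool | w.length = 2 * s ∧ IsDyckList w},
        (nestingCount P + nestingCount Q)
      = (s + 1) * catalan s ^ 2 := by
  simp only [finsum_mem_isDyckList, nestingCount_treeWord, Finset.sum_add_distrib,
    Finset.sum_const, treesOfNumNodesEq_card_eq_catalan, smul_eq_mul, ← Finset.mul_sum]
  linear_combination catalan s * sum_leftNilCount hs
end
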